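/- Fix a real number p with 0 < p < 1, and let h : ℕ → ℝ satisfy the hitting-probability system: h(0) = 0, h(1) = 1, and for every integer i ≥ 2, h(i) = Σ_{j=0}^{i} (i choose j) · p^{i−j} · (1−p)^j · h(j). Then for every integer i ≥ 1, h(i) ≥ 2(1−p)/(2−p). -/

import Mathlib

theorem stmt_0 (p : ℝ) (hp0 : 0 < p) (hp1 : p < 1) (h : ℕ → ℝ)
    (h0 : h 0 = 0) (h1 : h 1 = 1)
    (hrec : ∀ i : ℕ, 2 ≤ i →
      h i = ∑ j ∈ Finset.range (i + 1),
        (Nat.choose i j : ℝ) * p ^ (i - j) * (1 - p) ^ j * h j) :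
    ∀ i : ℕ, 1 ≤ i → h i ≥ 2 * (1 - p) / (2 - p) := by
  have hp2 : 0 < 2 - p := by linarith
  have hq : 0 < 1 - p := by linarith
  obtain ⟨c, hc⟩ : ∃ c, c = 2 * (1 - p) / (2 - p) := ⟨_, rfl⟩
  have hc' : c * (2 - p) = 2 * (1 - p) := by rw [hc]; field_simp
  have hc1 : c < 1 := by nlinarith
  rw [← hc]
  intro i
  induction i using Nat.strong_induction_on with
  | _ i ih =>
    intro hi
    obtain rfl | hi2 : i = 1 ∨ 2 ≤ i := by omega
    · rw [h1]; exact hc1.le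
    obtain ⟨k, rfl⟩ := Nat.exists_eq_add_of_le' hi2
    have hbinom : ∑ j ∈ Finset.range (k + 2 + 1),
        (Nat.choose (k + 2) j : ℝ) * p ^ (k + 2 - j) * (1 - p) ^ j = 1 := by
      have hpow := add_pow (1 - p) p (k + 2)
      rw [sub_add_cancel, one_pow] at hpow
      exact (hpow.trans (Finset.sum_congr rfl fun j _ => by ring)).symm
    have hdiff : h (k + 2) - c = ∑ j ∈ Finset.range (k + 2 + 1),
        (Nat.choose (k + 2) j : ℝ) * p ^ (k + 2 - j) * (1 - p) ^ j * (h j - c) := by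
      simp only [mul_sub, Finset.sum_sub_distrib]
      rw [← hrec _ hi2, ← Finset.sum_mul, hbinom, one_mul]
    rw [Finset.sum_range_succ, Finset.sum_range_succ', Finset.sum_range_succ'] at hdiff
    have hnonneg : 0 ≤ ∑ j ∈ Finset.range k, (Nat.choose (k + 2) (j + 1 + 1) : ℝ) *
        p ^ (k + 2 - (j + 1 + 1)) * (1 - p) ^ (j + 1 + 1) * (h (j + 1 + 1) - c) := by
      refine Finset.sum_nonneg fun j hj => ?_
      have hj' := Finset.mem_range.mp hj
      have := ih (j + 1 + 1) (by omega) (by omega)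
      exact mul_nonneg (by positivity) (by linarith)
    have hsub : k + 2 - (0 + 1) = k + 1 := by omega
    simp only [hsub, zero_add, Nat.choose_one_right, Nat.choose_zero_right, Nat.choose_self,
      Nat.sub_self, Nat.sub_zero, pow_zero, pow_one, h0, h1, Nat.cast_one, one_mul, mul_one]
      at hdiff
    have hexcess : 0 ≤ ((k + 2 : ℕ) : ℝ) * p ^ (k + 1) * (1 - p) * (1 - c) +
        p ^ (k + 2) * (0 - c) := by
      have hfactor : ((k + 2 : ℕ) : ℝ) * p ^ (k + 1) * (1 - p) * (1 - c) +
          p ^ (k + 2) * (0 - c) = k * p ^ (k + 1) * (1 - p) * (1 - c) := by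
        push_cast
        linear_combination -p ^ (k + 1) * hc'
      rw [hfactor]
      exact mul_nonneg (by positivity) (by linarith)
    have hlt : (1 - p) ^ (k + 2) < 1 := pow_lt_one₀ hq.le (by linarith) (by omega)
    have hprod : 0 ≤ (h (k + 2) - c) * (1 - (1 - p) ^ (k + 2)) := by
      linarith
    exact sub_nonneg.mp (nonneg_of_mul_nonneg_left hprod (by linarith))
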